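/- Under the Section 4 setup (pseudo-gradient flow φ for f on a Banach space E, index pair (N,L) with V = cl(N − L), f bounded on V, Palais–Smale in V, and no critical points of f in L ∩ V), there exists T ≥ 0 such that for every t ≥ T the set (φ_♯^t)^{-1}({[L]}) is a neighborhood of [L] in N/L. -/

import Mathlib

/-- The setoid on `N` collapsing the subset `L` to a single point, so that
`Quotient (collapse N L)` is the quotient space `N/L` with the quotient topology. -/
def collapse {X : Type*} (N L : Set X) : Setoid N where
  r x y := x = y ∨ ((x : X) ∈ L ∧ (y : X) ∈ L)
  iseqv := by
    refine ⟨fun x => Or.inl rfl, ?_, ?_⟩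
    · rintro x y (rfl | ⟨h1, h2⟩)
      · exact Or.inl rfl
      · exact Or.inr ⟨h2, h1⟩
    · rintro x y z (rfl | ⟨h1, h2⟩) (rfl | ⟨h3, h4⟩)
      · exact Or.inl rfl
      · exact Or.inr ⟨h3, h4⟩
      · exact Or.inr ⟨h1, h2⟩
      · exact Or.inr ⟨h1, h4⟩

/-- Under the Palais–Smale condition on `V`, the derivative of a `C¹` function that is bounded
on `V` is bounded away from zero on every closed subset of `V` without critical points. -/
theorem exists_pos_le_norm_fderiv_of_palaisSmale
    {E : Type*} [NormedAddCommGroup E] [NormedSpace ℝ E] {f : E → ℝ} (hf : ContDiff ℝ 1 f)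
    {V K : Set E} (hK : IsClosed K) (hKV : K ⊆ V) (hfb : ∃ C, ∀ x ∈ V, |f x| ≤ C)
    (hPS : ∀ u : ℕ → E, (∀ n, u n ∈ V) → (∃ C, ∀ n, |f (u n)| ≤ C) →
      Filter.Tendsto (fun n => ‖fderiv ℝ f (u n)‖) Filter.atTop (nhds 0) →
      ∃ x : E, ∃ σ : ℕ → ℕ, StrictMono σ ∧ Filter.Tendsto (u ∘ σ) Filter.atTop (nhds x))
    (hnc : ∀ x ∈ K, fderiv ℝ f x ≠ 0) :
    ∃ δ > 0, ∀ x ∈ K, δ ≤ ‖fderiv ℝ f x‖ := by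
  by_contra! hcon
  choose u huK hu using fun n : ℕ => hcon (1 / ((n : ℝ) + 1)) (by positivity)
  obtain ⟨C, hC⟩ := hfb
  have hu0 : Filter.Tendsto (fun n => ‖fderiv ℝ f (u n)‖) Filter.atTop (nhds 0) :=
    squeeze_zero (fun n => norm_nonneg _) (fun n => (hu n).le)
      tendsto_one_div_add_atTop_nhds_zero_nat
  obtain ⟨x, σ, hσ, hx⟩ :=
    hPS u (fun n => hKV (huK n)) ⟨C, fun n => hC _ (hKV (huK n))⟩ hu0
  have hxK : x ∈ K := hK.mem_of_tendsto hx (Filter.Eventually.of_forall fun n => huK (σ n))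
  have hlim : Filter.Tendsto (fun n => ‖fderiv ℝ f (u (σ n))‖) Filter.atTop
      (nhds ‖fderiv ℝ f x‖) :=
    ((hf.continuous_fderiv one_ne_zero).norm.tendsto x).comp hx
  exact hnc x hxK <| norm_eq_zero.mp <|
    tendsto_nhds_unique hlim (hu0.comp hσ.tendsto_atTop)

/-- If `f` grows at rate at least `c` along a curve on `[0, T]`, then it grows by at least
`c * T`. -/
theorem mul_le_sub_of_le_fderiv_along
    {E : Type*} [NormedAddCommGroup E] [NormedSpace ℝ E] {f : E → ℝ} (hf : Differentiable ℝ f)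
    {γ γ' : ℝ → E} (hγ : ∀ t, HasDerivAt γ (γ' t) t) {c T : ℝ} (hT : 0 ≤ T)
    (hc : ∀ t ∈ Set.Icc 0 T, c ≤ fderiv ℝ f (γ t) (γ' t)) :
    c * T ≤ f (γ T) - f (γ 0) := by
  have hd : ∀ t, HasDerivAt (fun s => f (γ s)) (fderiv ℝ f (γ t) (γ' t)) t := fun t =>
    (hf (γ t)).hasFDerivAt.comp_hasDerivAt t (hγ t)
  have h := (convex_Icc (0 : ℝ) T).mul_sub_le_image_sub_of_le_deriv
    (fun t _ => (hd t).continuousAt.continuousWithinAt)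
    (fun t _ => (hd t).differentiableAt.differentiableWithinAt)
    (fun t ht => (hd t).deriv ▸ hc t (interior_subset ht))
    0 ⟨le_rfl, hT⟩ T ⟨hT, le_rfl⟩ hT
  simpa using h

/-- A subset of `N/L` is a neighborhood of `[L]` as soon as its preimage contains a
neighborhood in `N` of every point of `L`. -/
theorem mem_nhds_mk_collapse {X : Type*} [TopologicalSpace X] {N L : Set X}
    {p : N} (hp : (p : X) ∈ L) {S : Set (Quotient (collapse N L))}
    (hS : ∀ x : N, (x : X) ∈ L → Quotient.mk (collapse N L) ⁻¹' S ∈ nhds x) :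
    S ∈ nhds (Quotient.mk (collapse N L) p) := by
  set U := interior (Quotient.mk (collapse N L) ⁻¹' S)
  have hLU : ∀ x : N, (x : X) ∈ L → x ∈ U := fun x hx => mem_interior_iff_mem_nhds.mpr (hS x hx)
  have hsat : Quotient.mk (collapse N L) ⁻¹' (Quotient.mk (collapse N L) '' U) = U := by
    refine Set.Subset.antisymm (fun x => ?_) (Set.subset_preimage_image _ _)
    rintro ⟨y, hy, hyx⟩
    rcases Quotient.exact hyx with rfl | ⟨-, hx⟩
    · exact hy
    · exact hLU x hx
  refine Filter.mem_of_superset (IsOpen.mem_nhds (?_ : IsOpen (Quotient.mk (collapse N L) '' U))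
    ⟨p, hLU p hp, rfl⟩) ?_
  · rw [← isQuotientMap_quotient_mk'.isOpen_preimage]
    exact hsat.symm ▸ isOpen_interior
  · exact Set.image_subset_iff.mpr interior_subset

theorem stmt13
    {E : Type*} [NormedAddCommGroup E] [NormedSpace ℝ E] [CompleteSpace E]
    (f : E → ℝ) (hf : ContDiff ℝ 1 f)
    -- α : [0,∞) → [0,∞) is strictly increasing and continuous with α(0) = 0
    (α : ℝ → ℝ) (hα1 : StrictMonoOn α (Set.Ici 0))
    (hα2 : ContinuousOn α (Set.Ici 0)) (hα3 : α 0 = 0)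
    (hα4 : ∀ r : ℝ, 0 ≤ r → 0 ≤ α r)
    -- Y is a pseudo-gradient vector field for f
    (Y : E → E) (hYb : ∃ C, ∀ x, ‖Y x‖ ≤ C)
    (hYg : ∀ x, α ‖fderiv ℝ f x‖ ≤ fderiv ℝ f x (Y x))
    (hY0 : ∀ x, fderiv ℝ f x = 0 → Y x = 0)
    -- φ is the flow of Y
    (φ : ℝ → E → E)
    (hφc : Continuous fun p : ℝ × E => φ p.1 p.2)
    (hφ0 : ∀ x, φ 0 x = x)
    (hφadd : ∀ s t x, φ (s + t) x = φ s (φ t x))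
    (hφode : ∀ x t, HasDerivAt (fun s : ℝ => φ s x) (Y (φ t x)) t)
    -- (N, L) is an index pair: closed, (i), (ii), cl(N − L) isolating
    (N L : Set E) (hN : IsClosed N) (hL : IsClosed L) (hLN : L ⊆ N)
    (hpos : ∀ x ∈ L, ∀ t ≥ (0 : ℝ), (∀ s ∈ Set.Icc 0 t, φ s x ∈ N) →
      ∀ s ∈ Set.Icc 0 t, φ s x ∈ L)
    (hexit : ∀ x ∈ N, ¬ (∀ t ≥ (0 : ℝ), φ t x ∈ N) →
      ∃ t ≥ (0 : ℝ), (∀ s ∈ Set.Icc 0 t, φ s x ∈ N) ∧ φ t x ∈ L)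
    (hiso : ∀ x ∈ closure (N \ L), (∀ t : ℝ, φ t x ∈ closure (N \ L)) →
      x ∈ interior (closure (N \ L)))
    -- f is bounded on V = cl(N − L)
    (hfb : ∃ C, ∀ x ∈ closure (N \ L), |f x| ≤ C)
    -- f satisfies the Palais–Smale condition in V
    (hPS : ∀ u : ℕ → E, (∀ n, u n ∈ closure (N \ L)) →
      (∃ C, ∀ n, |f (u n)| ≤ C) →
      Filter.Tendsto (fun n => ‖fderiv ℝ f (u n)‖) Filter.atTop (nhds 0) →
      ∃ x : E, ∃ σ : ℕ → ℕ, StrictMono σ ∧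
        Filter.Tendsto (u ∘ σ) Filter.atTop (nhds x))
    -- f has no critical points in L ∩ V
    (hnc : ∀ x ∈ L ∩ closure (N \ L), fderiv ℝ f x ≠ 0)
    -- the point [L] in N/L and the induced semiflow φ♯ on N/L
    (l₀ : E) (hl₀ : l₀ ∈ L)
    (ψ : ℝ → Quotient (collapse N L) → Quotient (collapse N L))
    (hψ1 : ∀ t : ℝ, ∀ ht : 0 ≤ t, ∀ x : N,
      ∀ h : (∀ s ∈ Set.Icc 0 t, φ s (x : E) ∈ N \ L),
      ψ t (Quotient.mk (collapse N L) x) =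
        Quotient.mk (collapse N L) ⟨φ t (x : E), (h t ⟨ht, le_rfl⟩).1⟩)
    (hψ2 : ∀ t : ℝ, 0 ≤ t → ∀ x : N,
      ¬ (∀ s ∈ Set.Icc 0 t, φ s (x : E) ∈ N \ L) →
      ψ t (Quotient.mk (collapse N L) x) = Quotient.mk (collapse N L) ⟨l₀, hLN hl₀⟩) :
    ∃ T ≥ (0 : ℝ), ∀ t ≥ T,
      (ψ t) ⁻¹' {Quotient.mk (collapse N L) ⟨l₀, hLN hl₀⟩} ∈
        nhds (Quotient.mk (collapse N L) ⟨l₀, hLN hl₀⟩) := by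
  set V := closure (N \ L)
  have hVN : V ⊆ N := hN.closure_subset_iff.mpr Set.sdiff_subset
  obtain ⟨δ, hδ, hδle⟩ := exists_pos_le_norm_fderiv_of_palaisSmale hf
    (hL.inter isClosed_closure) Set.inter_subset_right hfb hPS hnc
  have hαδ : 0 < α δ := hα3 ▸ hα1 Set.self_mem_Ici (Set.mem_Ici.mpr hδ.le) hδ
  obtain ⟨C, hC⟩ := hfb
  obtain ⟨T, hT0, hT⟩ : ∃ T ≥ (0 : ℝ), 2 * C < α δ * T := by
    refine ⟨(2 * |C| + 1) / α δ, by positivity, ?_⟩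
    rw [mul_div_cancel₀ _ hαδ.ne']
    linarith [le_abs_self C]
  have hleave : ∀ x ∈ L, ∃ s ∈ Set.Icc 0 T, φ s x ∉ V := by
    intro x hx
    by_contra! hstay
    have hgrow := mul_le_sub_of_le_fderiv_along (hf.differentiable one_ne_zero) (hφode x) hT0
      (c := α δ) fun t ht => (hα1.monotoneOn (Set.mem_Ici.mpr hδ.le)
        (Set.mem_Ici.mpr (norm_nonneg _)) (hδle (φ t x)
          ⟨hpos x hx T hT0 (fun s hs => hVN (hstay s hs)) t ht, hstay t ht⟩)).trans (hYg _)
    have h0 := abs_le.mp (hC _ (hstay 0 ⟨le_rfl, hT0⟩))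
    have h1 := abs_le.mp (hC _ (hstay T ⟨hT0, le_rfl⟩))
    linarith [h0.1, h1.2]
  refine ⟨T, hT0, fun t ht => mem_nhds_mk_collapse hl₀ fun x hx => ?_⟩
  obtain ⟨s, hs, hsV⟩ := hleave x hx
  have hcont : Continuous fun y : N => φ s y :=
    hφc.comp (continuous_const.prodMk continuous_subtype_val)
  filter_upwards [hcont.continuousAt.preimage_mem_nhds
    (isClosed_closure.isOpen_compl.mem_nhds hsV)] with y hy
  exact hψ2 t (hT0.trans ht) y fun h => hy (subset_closure (h s ⟨hs.1, hs.2.trans ht⟩))
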